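/- arXiv:2408.15923 — 3 statements merged into one kernel-verified Lean document; each statement's English description precedes it below -/
import Mathlib

section
/- Let X_1,...,X_d and Y be discrete random variables with values in finite sets, jointly distributed according to a strictly positive probability mass function P. Define the Naive Bayes approximation P_NB(x_1,...,x_d,y) = P_Y(y) · ∏_{i=1}^d P(x_i | y), where P_Y and P(x_i|y) are computed from the marginals of P. Then the Kullback–Leibler divergence between P and P_NB satisfies KL(P ‖ P_NB) = Σ_{i=1}^d H(X_i) + H(Y) − H(X_1,...,X_d,Y) − Σ_{i=1}^d I(X_i; Y). -/
open scoped Classical BigOperators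
open Real

noncomputable section

namespace GNB

variable {d : ℕ} {α : Fin d → Type} {β : Type} [∀ i, Fintype (α i)] [Fintype β]

/-- A joint configuration of the explanatory variables `X i` and the class variable `Y`. -/
abbrev Cfg (α : Fin d → Type) (β : Type) := ((i : Fin d) → α i) × β

/-- Marginal pmf of the class variable `Y`. -/
def margY (P : Cfg α β → ℝ) (y : β) : ℝ := ∑ x : (i : Fin d) → α i, P (x, y)

/-- Marginal pmf of the variable `X i`. -/
def margX (P : Cfg α β → ℝ) (i : Fin d) (a : α i) : ℝ :=
  ∑ z : Cfg α β, if z.1 i = a then P z else 0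

/-- Marginal pmf of the pair `(X i, Y)`. -/
def margXY (P : Cfg α β → ℝ) (i : Fin d) (a : α i) (y : β) : ℝ :=
  ∑ x : (i : Fin d) → α i, if x i = a then P (x, y) else 0

/-- Marginal pmf of the triplet `(X i, X j, Y)`. -/
def margXXY (P : Cfg α β → ℝ) (i j : Fin d) (a : α i) (b : α j) (y : β) : ℝ :=
  ∑ x : (i : Fin d) → α i, if x i = a ∧ x j = b then P (x, y) else 0

/-- Joint entropy `H(X_1,…,X_d,Y)`. -/
def HJoint (P : Cfg α β → ℝ) : ℝ := -∑ z : Cfg α β, P z * Real.log (P z)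

/-- Entropy `H(Y)`. -/
def HY (P : Cfg α β → ℝ) : ℝ := -∑ y : β, margY P y * Real.log (margY P y)

/-- Entropy `H(X i)`. -/
def HX (P : Cfg α β → ℝ) (i : Fin d) : ℝ :=
  -∑ a : α i, margX P i a * Real.log (margX P i a)

/-- Entropy `H(Y, X i)`. -/
def HYX (P : Cfg α β → ℝ) (i : Fin d) : ℝ :=
  -∑ y : β, ∑ a : α i, margXY P i a y * Real.log (margXY P i a y)

/-- Entropy `H(Y, X i, X j)`. -/
def HYXX (P : Cfg α β → ℝ) (i j : Fin d) : ℝ :=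
  -∑ y : β, ∑ a : α i, ∑ b : α j, margXXY P i j a b y * Real.log (margXXY P i j a b y)

/-- Mutual information `I(X i ; Y)`. -/
def IY2 (P : Cfg α β → ℝ) (i : Fin d) : ℝ :=
  ∑ y : β, ∑ a : α i, margXY P i a y *
    Real.log (margXY P i a y / (margX P i a * margY P y))

/-- Information content `I(Y, X i, X j)`. -/
def IY3 (P : Cfg α β → ℝ) (i j : Fin d) : ℝ :=
  ∑ y : β, ∑ a : α i, ∑ b : α j, margXXY P i j a b y *
    Real.log (margXXY P i j a b y / (margY P y * margX P i a * margX P j b))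

/-- Kullback–Leibler divergence `KL(p ‖ q)`. -/
def KL {γ : Type} [Fintype γ] (p q : γ → ℝ) : ℝ := ∑ c : γ, p c * Real.log (p c / q c)

/-- The Naive Bayes approximation `P_NB(x,y) = P(y) ∏ i, P(x i | y)`. -/
def PNB (P : Cfg α β → ℝ) : Cfg α β → ℝ :=
  fun z => margY P z.2 * ∏ i : Fin d, (margXY P i (z.1 i) z.2 / margY P z.2)

/-- The Generalized Naive Bayes approximation determined by the mother function `μ`:
`P_GNB(x,y) = (∏_{i=2}^d P(y, x_{μ i}, x_i)) / (∏_{i=3}^d P(y, x_{μ i}))`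
(indices are `0`-based: variable `X_k` of the paper is `X (k-1)` here). -/
def PGNB (P : Cfg α β → ℝ) (μ : Fin d → Fin d) : Cfg α β → ℝ :=
  fun z =>
    (∏ i ∈ Finset.univ.filter (fun i : Fin d => 1 ≤ (i : ℕ)),
        margXXY P (μ i) i (z.1 (μ i)) (z.1 i) z.2) /
    (∏ i ∈ Finset.univ.filter (fun i : Fin d => 2 ≤ (i : ℕ)),
        margXY P (μ i) (z.1 (μ i)) z.2)

/-- Predecessor on `Fin d` (truncated at `0`). -/
def pred (i : Fin d) : Fin d := ⟨(i : ℕ) - 1, lt_of_le_of_lt (Nat.sub_le _ _) i.isLt⟩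

end GNB

namespace GNB

variable {d : ℕ} {α : Fin d → Type} {β : Type} [∀ i, Fintype (α i)]

lemma margY_pos {P : Cfg α β → ℝ} (hpos : ∀ z, 0 < P z) (z : Cfg α β) :
    0 < margY P z.2 :=
  Finset.sum_pos (fun x _ => hpos (x, z.2)) ⟨z.1, Finset.mem_univ _⟩

lemma margXY_pos {P : Cfg α β → ℝ} (hpos : ∀ z, 0 < P z) (z : Cfg α β) (i : Fin d) :
    0 < margXY P i (z.1 i) z.2 :=
  Finset.sum_pos' (fun x _ => by split_ifs <;> simp [(hpos (x, z.2)).le])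
    ⟨z.1, Finset.mem_univ _, by simpa using hpos z⟩

variable [Fintype β]

lemma sum_mul_snd (P : Cfg α β → ℝ) (f : β → ℝ) :
    ∑ z, P z * f z.2 = ∑ y, margY P y * f y := by
  simp only [margY, Finset.sum_mul]
  exact Fintype.sum_prod_type_right _

lemma sum_mul_fst_apply (P : Cfg α β → ℝ) (i : Fin d) (f : α i → ℝ) :
    ∑ z, P z * f (z.1 i) = ∑ a, margX P i a * f a := by
  simp only [margX, Finset.sum_mul]
  rw [Finset.sum_comm]
  simp [ite_mul]

lemma sum_mul_fst_apply_snd (P : Cfg α β → ℝ) (i : Fin d) (f : α i → β → ℝ) :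
    ∑ z, P z * f (z.1 i) z.2 = ∑ y, ∑ a, margXY P i a y * f a y := by
  simp only [margXY, Finset.sum_mul]
  rw [Fintype.sum_prod_type_right]
  refine Finset.sum_congr rfl fun y _ => ?_
  rw [Finset.sum_comm]
  simp [ite_mul]

lemma margX_pos {P : Cfg α β → ℝ} (hpos : ∀ z, 0 < P z) (z : Cfg α β) (i : Fin d) :
    0 < margX P i (z.1 i) :=
  Finset.sum_pos' (fun w _ => by split_ifs <;> simp [(hpos w).le])
    ⟨z, Finset.mem_univ _, by simpa using hpos z⟩

lemma log_div_PNB {P : Cfg α β → ℝ} (hpos : ∀ z, 0 < P z) (z : Cfg α β) :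
    Real.log (P z / PNB P z) =
      Real.log (P z) - Real.log (margY P z.2) - ∑ i, Real.log (margX P i (z.1 i)) -
        ∑ i, Real.log (margXY P i (z.1 i) z.2 / (margX P i (z.1 i) * margY P z.2)) := by
  have hY := (margY_pos hpos z).ne'
  have hX i := (margX_pos hpos z i).ne'
  have hXY i := (margXY_pos hpos z i).ne'
  have hq i : margXY P i (z.1 i) z.2 / margY P z.2 ≠ 0 := div_ne_zero (hXY i) hY
  have hprod : ∏ i, (margXY P i (z.1 i) z.2 / margY P z.2) ≠ 0 :=
    Finset.prod_ne_zero_iff.mpr fun i _ => hq i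
  rw [PNB, Real.log_div (hpos z).ne' (mul_ne_zero hY hprod), Real.log_mul hY hprod,
    Real.log_prod fun i _ => hq i, sub_sub _ (∑ i, _), ← Finset.sum_add_distrib, ← sub_sub]
  congr 1
  refine Finset.sum_congr rfl fun i _ => ?_
  rw [Real.log_div (hXY i) hY, Real.log_div (hXY i) (mul_ne_zero (hX i) hY),
    Real.log_mul (hX i) hY]
  ring

end GNB

/-- KL divergence of the Naive Bayes approximation:
`KL(P ‖ P_NB) = Σᵢ H(Xᵢ) + H(Y) − H(X₁,…,X_d,Y) − Σᵢ I(Xᵢ;Y)`. -/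
theorem kl_naiveBayes (d : ℕ) (α : Fin d → Type) (β : Type)
    [∀ i, Fintype (α i)] [∀ i, Nonempty (α i)] [Fintype β] [Nonempty β]
    (P : GNB.Cfg α β → ℝ) (hpos : ∀ z, 0 < P z) (hsum : ∑ z, P z = 1) :
    GNB.KL P (GNB.PNB P) =
      (∑ i, GNB.HX P i) + GNB.HY P - GNB.HJoint P - ∑ i, GNB.IY2 P i := by
  have hX i : GNB.HX P i = -∑ z, P z * Real.log (GNB.margX P i (z.1 i)) := by
    rw [GNB.HX, GNB.sum_mul_fst_apply P i fun a => Real.log (GNB.margX P i a)]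
  have hY : GNB.HY P = -∑ z, P z * Real.log (GNB.margY P z.2) := by
    rw [GNB.HY, GNB.sum_mul_snd P fun y => Real.log (GNB.margY P y)]
  have hI i : GNB.IY2 P i = ∑ z, P z * Real.log
      (GNB.margXY P i (z.1 i) z.2 / (GNB.margX P i (z.1 i) * GNB.margY P z.2)) := by
    rw [GNB.IY2, GNB.sum_mul_fst_apply_snd P i fun a y => Real.log
      (GNB.margXY P i a y / (GNB.margX P i a * GNB.margY P y))]
  simp only [GNB.KL, GNB.log_div_PNB hpos, mul_sub, Finset.sum_sub_distrib, Finset.mul_sum,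
    hX, hY, hI, GNB.HJoint, Finset.sum_neg_distrib]
  rw [Finset.sum_comm (s := Finset.univ (α := Fin d)),
    Finset.sum_comm (s := Finset.univ (α := Fin d))]
  ring
end
end

section
/- Let X_1,...,X_d (d ≥ 2) and Y be discrete random variables with values in finite sets, jointly distributed with strictly positive pmf P, with the indexing 1,...,d regarded as a chain numbering (each cluster (Y, X_i, X_{i+1}) overlaps the next in (Y, X_{i+1})). Then Σ_{i=1}^{d−1} I(Y, X_i, X_{i+1}) − Σ_{i=2}^{d−1} I(Y, X_i) = Σ_{i=1}^d H(X_i) + H(Y) − Σ_{i=1}^{d−1} H(X_i | Y, X_{i+1}) − H(Y, X_d). -/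
open scoped Classical BigOperators
open Real

noncomputable section

namespace GNB

variable {d : ℕ} {α : Fin d → Type} {β : Type} [∀ i, Fintype (α i)]

lemma sum_margXXY_right (P : Cfg α β → ℝ) (i j : Fin d) (a : α i) (y : β) :
    ∑ b, margXXY P i j a b y = margXY P i a y := by
  unfold margXXY margXY
  rw [Finset.sum_comm]
  refine Finset.sum_congr rfl fun x _ => ?_
  by_cases h : x i = a <;> simp [h]

lemma sum_margXXY_left (P : Cfg α β → ℝ) (i j : Fin d) (b : α j) (y : β) :
    ∑ a, margXXY P i j a b y = margXY P j b y := by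
  unfold margXXY margXY
  rw [Finset.sum_comm]
  refine Finset.sum_congr rfl fun x _ => ?_
  by_cases h : x j = b <;> simp [h]

lemma sum_margXY_left (P : Cfg α β → ℝ) (i : Fin d) (y : β) :
    ∑ a, margXY P i a y = margY P y := by
  unfold margXY margY
  rw [Finset.sum_comm]
  simp

lemma margXXY_nonneg {P : Cfg α β → ℝ} (hP : ∀ z, 0 ≤ P z) (i j : Fin d) (a : α i) (b : α j)
    (y : β) : 0 ≤ margXXY P i j a b y :=
  Finset.sum_nonneg fun x _ => by split_ifs <;> simp [hP]

lemma margXY_nonneg {P : Cfg α β → ℝ} (hP : ∀ z, 0 ≤ P z) (i : Fin d) (a : α i) (y : β) :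
    0 ≤ margXY P i a y :=
  Finset.sum_nonneg fun x _ => by split_ifs <;> simp [hP]

lemma margXXY_le_left {P : Cfg α β → ℝ} (hP : ∀ z, 0 ≤ P z) (i j : Fin d) (a : α i) (b : α j)
    (y : β) : margXXY P i j a b y ≤ margXY P i a y := by
  rw [← sum_margXXY_right P i j a y]
  exact Finset.single_le_sum (f := fun b => margXXY P i j a b y)
    (fun b _ => margXXY_nonneg hP i j a b y) (Finset.mem_univ b)

lemma margXXY_le_right {P : Cfg α β → ℝ} (hP : ∀ z, 0 ≤ P z) (i j : Fin d) (a : α i) (b : α j)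
    (y : β) : margXXY P i j a b y ≤ margXY P j b y := by
  rw [← sum_margXXY_left P i j b y]
  exact Finset.single_le_sum (f := fun a => margXXY P i j a b y)
    (fun a _ => margXXY_nonneg hP i j a b y) (Finset.mem_univ a)

lemma margXY_le_margY {P : Cfg α β → ℝ} (hP : ∀ z, 0 ≤ P z) (i : Fin d) (a : α i) (y : β) :
    margXY P i a y ≤ margY P y := by
  rw [← sum_margXY_left P i y]
  exact Finset.single_le_sum (f := fun a => margXY P i a y)
    (fun a _ => margXY_nonneg hP i a y) (Finset.mem_univ a)

variable [Fintype β]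

lemma sum_margXY_right (P : Cfg α β → ℝ) (i : Fin d) (a : α i) :
    ∑ y, margXY P i a y = margX P i a := by
  unfold margXY margX
  rw [Fintype.sum_prod_type_right]

lemma margXY_le_margX {P : Cfg α β → ℝ} (hP : ∀ z, 0 ≤ P z) (i : Fin d) (a : α i) (y : β) :
    margXY P i a y ≤ margX P i a := by
  rw [← sum_margXY_right P i a]
  exact Finset.single_le_sum (f := fun y => margXY P i a y)
    (fun y _ => margXY_nonneg hP i a y) (Finset.mem_univ y)

lemma sum_margXY_mul_log_margX (P : Cfg α β → ℝ) (i : Fin d) :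
    ∑ y, ∑ a, margXY P i a y * Real.log (margX P i a) = -HX P i := by
  rw [Finset.sum_comm]
  simp_rw [← Finset.sum_mul, sum_margXY_right]
  simp [HX]

lemma sum_margXY_mul_log_margY (P : Cfg α β → ℝ) (i : Fin d) :
    ∑ y, ∑ a, margXY P i a y * Real.log (margY P y) = -HY P := by
  simp_rw [← Finset.sum_mul, sum_margXY_left]
  simp [HY]

lemma IY2_eq_entropy {P : Cfg α β → ℝ} (hP : ∀ z, 0 ≤ P z) (i : Fin d) :
    IY2 P i = HX P i + HY P - HYX P i := by
  have key : ∀ y a, margXY P i a y * Real.log (margXY P i a y / (margX P i a * margY P y)) =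
      margXY P i a y * Real.log (margXY P i a y) - margXY P i a y * Real.log (margX P i a)
        - margXY P i a y * Real.log (margY P y) := by
    intro y a
    rcases (margXY_nonneg hP i a y).eq_or_lt with h | h
    · simp [← h]
    · have hX := h.trans_le (margXY_le_margX hP i a y)
      have hY := h.trans_le (margXY_le_margY hP i a y)
      rw [Real.log_div h.ne' (by positivity), Real.log_mul hX.ne' hY.ne']
      ring
  simp_rw [IY2, key, Finset.sum_sub_distrib]
  rw [sum_margXY_mul_log_margX, sum_margXY_mul_log_margY, HYX]
  ring

lemma IY3_eq_entropy {P : Cfg α β → ℝ} (hP : ∀ z, 0 ≤ P z) (i j : Fin d) :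
    IY3 P i j = HY P + HX P i + HX P j - HYXX P i j := by
  have key : ∀ y a b, margXXY P i j a b y *
      Real.log (margXXY P i j a b y / (margY P y * margX P i a * margX P j b)) =
      margXXY P i j a b y * Real.log (margXXY P i j a b y)
        - margXXY P i j a b y * Real.log (margY P y)
        - margXXY P i j a b y * Real.log (margX P i a)
        - margXXY P i j a b y * Real.log (margX P j b) := by
    intro y a b
    rcases (margXXY_nonneg hP i j a b y).eq_or_lt with h | h
    · simp [← h]
    · have hiY := h.trans_le (margXXY_le_left hP i j a b y)
      have hi := hiY.trans_le (margXY_le_margX hP i a y)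
      have hj := (h.trans_le (margXXY_le_right hP i j a b y)).trans_le (margXY_le_margX hP j b y)
      have hY := hiY.trans_le (margXY_le_margY hP i a y)
      rw [Real.log_div h.ne' (by positivity), Real.log_mul (by positivity) hj.ne',
        Real.log_mul hY.ne' hi.ne']
      ring
  have hlogY : ∑ y, ∑ a, ∑ b, margXXY P i j a b y * Real.log (margY P y) = -HY P := by
    simp_rw [← Finset.sum_mul _ _ (Real.log _), sum_margXXY_right, sum_margXY_left]
    simp [HY]
  have hlogi : ∑ y, ∑ a, ∑ b, margXXY P i j a b y * Real.log (margX P i a) = -HX P i := by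
    simp_rw [← Finset.sum_mul, sum_margXXY_right]
    exact sum_margXY_mul_log_margX P i
  have hlogj : ∑ y, ∑ a, ∑ b, margXXY P i j a b y * Real.log (margX P j b) = -HX P j := by
    rw [← sum_margXY_mul_log_margX P j]
    refine Finset.sum_congr rfl fun y _ => ?_
    rw [Finset.sum_comm]
    simp_rw [← Finset.sum_mul, sum_margXXY_left]
  simp_rw [IY3, key, Finset.sum_sub_distrib]
  rw [hlogY, hlogi, hlogj, HYXX]
  ring

lemma sum_filter_one_le {n : ℕ} (f : Fin (n + 2) → ℝ) :
    ∑ i ∈ Finset.univ.filter (fun i : Fin (n + 2) => 1 ≤ (i : ℕ)), f i =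
      ∑ i : Fin (n + 1), f i.succ := by
  rw [Finset.sum_filter, Fin.sum_univ_succ]
  simp

lemma sum_filter_two_le {n : ℕ} (f : Fin (n + 2) → ℝ) :
    ∑ i ∈ Finset.univ.filter (fun i : Fin (n + 2) => 2 ≤ (i : ℕ)), f i =
      ∑ i : Fin n, f i.succ.succ := by
  rw [Finset.sum_filter, Fin.sum_univ_succ, Fin.sum_univ_succ]
  simp

lemma pred_succ {n : ℕ} (i : Fin n) : pred i.succ = i.castSucc := by
  ext
  simp [pred]

end GNB

/-- The weight of the chain Generalized Naive Bayes approximation: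
`Σ_{i=1}^{d−1} I(Y,Xᵢ,Xᵢ₊₁) − Σ_{i=2}^{d−1} I(Y,Xᵢ)
  = Σ_{i=1}^d H(Xᵢ) + H(Y) − Σ_{i=1}^{d−1} H(Xᵢ | Y,Xᵢ₊₁) − H(Y,X_d)`
(indices are `0`-based, and the sums over `i = 1,…,d−1` are reindexed by `k = i+1`,
so they run over `k` with `1 ≤ k`, the cluster being `(Y, X_{pred k}, X_k)`;
`H(A|B) = H(A,B) − H(B)`). -/
theorem weight_chain_gnb (d : ℕ) (hd : 2 ≤ d) (α : Fin d → Type) (β : Type)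
    [∀ i, Fintype (α i)] [∀ i, Nonempty (α i)] [Fintype β] [Nonempty β]
    (P : GNB.Cfg α β → ℝ) (hpos : ∀ z, 0 < P z) (hsum : ∑ z, P z = 1) :
    (∑ i ∈ Finset.univ.filter (fun i : Fin d => 1 ≤ (i : ℕ)), GNB.IY3 P (GNB.pred i) i)
      - (∑ i ∈ Finset.univ.filter (fun i : Fin d => 2 ≤ (i : ℕ)), GNB.IY2 P (GNB.pred i)) =
    (∑ i, GNB.HX P i) + GNB.HY P
      - (∑ i ∈ Finset.univ.filter (fun i : Fin d => 1 ≤ (i : ℕ)),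
          (GNB.HYXX P (GNB.pred i) i - GNB.HYX P i))
      - GNB.HYX P ⟨d - 1, by omega⟩ := by
  obtain ⟨n, rfl⟩ := Nat.exists_eq_add_of_le' hd
  have hP : ∀ z, 0 ≤ P z := fun z => (hpos z).le
  have hlast : (⟨n + 2 - 1, by omega⟩ : Fin (n + 2)) = (Fin.last n).succ := by
    ext
    simp
  simp only [GNB.sum_filter_one_le, GNB.sum_filter_two_le, GNB.pred_succ, GNB.IY3_eq_entropy hP,
    GNB.IY2_eq_entropy hP, hlast, Finset.sum_add_distrib, Finset.sum_sub_distrib]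
  rw [Fin.sum_univ_succ (fun i : Fin (n + 1) => GNB.HX P i.castSucc),
    Fin.sum_univ_castSucc (fun i : Fin (n + 1) => GNB.HYX P i.succ), Fin.sum_univ_succ (GNB.HX P)]
  simp only [Finset.sum_const, Finset.card_univ, Fintype.card_fin, nsmul_eq_mul,
    Fin.succ_castSucc, Fin.castSucc_zero]
  push_cast
  ring
end
end

section
/- Let X_1,...,X_d (d ≥ 2) and Y be discrete random variables with values in finite sets, jointly distributed with strictly positive pmf P, and let μ : {2,...,d} → {1,...,d} be a mother function (μ(i) < i for all i, μ(2) = 1). Let T_μ be the tree on {1,...,d} whose edges are {i, μ(i)} for i = 2,...,d, and let deg(v) denote the degree of v in T_μ. Then the weight of the Generalized Naive Bayes approximation depends only on the tree T_μ: Σ_{i=2}^d I(Y, X_{μ(i)}, X_i) − Σ_{i=3}^d I(Y, X_{μ(i)}) = Σ_{{u,v} ∈ E(T_μ)} I(Y, X_u, X_v) − Σ_{v=1}^d (deg(v) − 1) · I(Y, X_v). -/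
open scoped Classical BigOperators
open Real

noncomputable section

section MotherTree

variable {d : ℕ} {μ : Fin d → Fin d} {T : SimpleGraph (Fin d)}

/-- In the tree of a mother function, the smaller endpoint of an edge is the mother of the
larger one. -/
theorem adj_and_lt_iff_mother (hμ : ∀ i : Fin d, 0 < (i : ℕ) → μ i < i)
    (hT : ∀ u v : Fin d, T.Adj u v ↔
      (∃ i : Fin d, 0 < (i : ℕ) ∧ ((u = μ i ∧ v = i) ∨ (u = i ∧ v = μ i))))
    (u v : Fin d) : (T.Adj u v ∧ u < v) ↔ (0 < (v : ℕ) ∧ u = μ v) := by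
  rw [hT]
  constructor
  · rintro ⟨⟨i, hi, ⟨rfl, rfl⟩ | ⟨rfl, rfl⟩⟩, hlt⟩
    · exact ⟨hi, rfl⟩
    · exact absurd hlt (hμ _ hi).not_gt
  · rintro ⟨hv, rfl⟩
    exact ⟨⟨v, hv, Or.inl ⟨rfl, rfl⟩⟩, hμ v hv⟩

/-- Summing over the edges of the tree amounts to summing over the non-root vertices. -/
theorem sum_edges_eq_sum_mother (hμ : ∀ i : Fin d, 0 < (i : ℕ) → μ i < i)
    (hT : ∀ u v : Fin d, T.Adj u v ↔
      (∃ i : Fin d, 0 < (i : ℕ) ∧ ((u = μ i ∧ v = i) ∨ (u = i ∧ v = μ i))))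
    (g : Fin d → Fin d → ℝ) :
    ∑ p ∈ Finset.univ.filter (fun p : Fin d × Fin d => T.Adj p.1 p.2 ∧ p.1 < p.2), g p.1 p.2 =
      ∑ i ∈ Finset.univ.filter (fun i : Fin d => 0 < (i : ℕ)), g (μ i) i := by
  simp only [adj_and_lt_iff_mother hμ hT, Finset.sum_filter]
  rw [Fintype.sum_prod_type_right]
  refine Finset.sum_congr rfl fun v _ => ?_
  by_cases hv : 0 < (v : ℕ) <;> simp [hv]

/-- The degree-weighted vertex sum is the sum over all edges of the values at both endpoints. -/
theorem sum_degree_mul_eq (hμ : ∀ i : Fin d, 0 < (i : ℕ) → μ i < i)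
    (hT : ∀ u v : Fin d, T.Adj u v ↔
      (∃ i : Fin d, 0 < (i : ℕ) ∧ ((u = μ i ∧ v = i) ∨ (u = i ∧ v = μ i))))
    (f : Fin d → ℝ) :
    ∑ v : Fin d, ((Finset.univ.filter (fun u : Fin d => T.Adj v u)).card : ℝ) * f v =
      ∑ i ∈ Finset.univ.filter (fun i : Fin d => 0 < (i : ℕ)), (f (μ i) + f i) := by
  have key : ∀ v u : Fin d, (if T.Adj v u then f v else 0) =
      (if T.Adj v u ∧ v < u then f v else 0) + (if T.Adj u v ∧ u < v then f v else 0) := by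
    intro v u
    rw [T.adj_comm u v]
    by_cases h : T.Adj v u
    · rcases h.ne.lt_or_gt with hlt | hlt <;> simp [h, hlt, hlt.not_gt]
    · simp [h]
  have hcard : ∀ v : Fin d, ((Finset.univ.filter (fun u : Fin d => T.Adj v u)).card : ℝ) * f v =
      ∑ u : Fin d, if T.Adj v u then f v else 0 := by
    intro v
    rw [← Finset.sum_filter, Finset.sum_const, nsmul_eq_mul]
  rw [Finset.sum_add_distrib, ← sum_edges_eq_sum_mother hμ hT fun u _ => f u,
    ← sum_edges_eq_sum_mother hμ hT fun _ v => f v]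
  simp only [hcard, key, Finset.sum_add_distrib, Finset.sum_filter]
  rw [Fintype.sum_prod_type, Fintype.sum_prod_type_right]

end MotherTree

/-- The weight of a Generalized Naive Bayes approximation depends only on
the underlying tree `T_μ` (edges `{i, μ i}` for `i ≠ 0`, `0`-based indices):
`Σ_{i=2}^d I(Y,X_{μ i},Xᵢ) − Σ_{i=3}^d I(Y,X_{μ i})
  = Σ_{{u,v} ∈ E(T_μ)} I(Y,X_u,X_v) − Σ_v (deg v − 1)·I(Y,X_v)`.
The sum over edges is formalized as a sum over ordered pairs `(u,v)` with `u < v`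
and `u,v` adjacent in `T_μ`, so that each edge is counted exactly once, and
`deg v` is the number of vertices adjacent to `v` in `T_μ`. -/
theorem gnb_weight_tree (d : ℕ) (hd : 2 ≤ d) (α : Fin d → Type) (β : Type)
    [∀ i, Fintype (α i)] [∀ i, Nonempty (α i)] [Fintype β] [Nonempty β]
    (P : GNB.Cfg α β → ℝ) (hpos : ∀ z, 0 < P z) (hsum : ∑ z, P z = 1)
    (μ : Fin d → Fin d) (hμ : ∀ i : Fin d, 0 < (i : ℕ) → μ i < i)
    (T : SimpleGraph (Fin d))
    (hT : ∀ u v : Fin d, T.Adj u v ↔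
      (∃ i : Fin d, 0 < (i : ℕ) ∧ ((u = μ i ∧ v = i) ∨ (u = i ∧ v = μ i)))) :
    (∑ i ∈ Finset.univ.filter (fun i : Fin d => 1 ≤ (i : ℕ)), GNB.IY3 P (μ i) i)
      - (∑ i ∈ Finset.univ.filter (fun i : Fin d => 2 ≤ (i : ℕ)), GNB.IY2 P (μ i)) =
    (∑ p ∈ Finset.univ.filter (fun p : Fin d × Fin d => T.Adj p.1 p.2 ∧ p.1 < p.2),
        GNB.IY3 P p.1 p.2)
      - ∑ v : Fin d,
          (((Finset.univ.filter (fun u : Fin d => T.Adj v u)).card : ℝ) - 1) * GNB.IY2 P v := by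
  obtain ⟨n, rfl⟩ := Nat.exists_eq_add_of_le' hd
  have hmother : μ 1 = 0 := by
    have h := hμ 1 (by simp)
    rw [Fin.lt_def, Fin.val_one] at h
    exact Fin.ext (by simpa using h)
  have hsplit : ∀ f : Fin (n + 2) → ℝ,
      ∑ i ∈ Finset.univ.filter (fun i : Fin (n + 2) => 0 < (i : ℕ)), f i =
        f 1 + ∑ i ∈ Finset.univ.filter (fun i : Fin (n + 2) => 2 ≤ (i : ℕ)), f i := by
    intro f
    simp [Finset.sum_filter, Fin.sum_univ_succ]
  rw [sum_edges_eq_sum_mother hμ hT]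
  simp only [sub_mul, one_mul, Finset.sum_sub_distrib]
  rw [sum_degree_mul_eq hμ hT, Finset.sum_add_distrib, hsplit fun i => GNB.IY2 P (μ i), hmother]
  have hroot : ∑ v, GNB.IY2 P v = GNB.IY2 P 0 +
      ∑ i ∈ Finset.univ.filter (fun i : Fin (n + 2) => 0 < (i : ℕ)), GNB.IY2 P i := by
    simp [Finset.sum_filter, Fin.sum_univ_succ]
  rw [hroot]
  simp only [Nat.one_le_iff_ne_zero, Nat.pos_iff_ne_zero]
  ring
end
end
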